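/- The two representations of the Jacobi theta function agree: for Im(\tau) > 0, q = e^{2\pi i\tau}, and all complex z, -i \sum_{n\in\mathbb{Z}} (-1)^n e^{(n+1/2)^2 \pi i \tau + (2n+1) i z} = 2 \sin(z) q^{1/8} \prod_{n\ge 1} (1 - 2\cos(2z) q^n + q^{2n})(1 - q^n), where q^{1/8} = e^{\pi i \tau/4}. -/

import Mathlib

open Complex

/-- The finite `q`-Pochhammer symbol `(q; q)_n`. -/
noncomputable def qPoch (q : ℂ) (n : ℕ) : ℂ := ∏ k ∈ Finset.range n, (1 - q ^ (k + 1))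

/-- The Gaussian binomial coefficient, defined by a `q`-Pascal recursion. -/
noncomputable def gaussBinom (q : ℂ) : ℕ → ℕ → ℂ
  | _, 0 => 1
  | 0, _ + 1 => 0
  | n + 1, k + 1 => gaussBinom q n (k + 1) + q ^ (n - k) * gaussBinom q n k

section Finite

open Finset

lemma qPoch_succ (q : ℂ) (n : ℕ) : qPoch q (n + 1) = qPoch q n * (1 - q ^ (n + 1)) :=
  prod_range_succ _ _

lemma gaussBinom_zero_right (q : ℂ) (n : ℕ) : gaussBinom q n 0 = 1 := by
  cases n <;> rfl

lemma gaussBinom_succ_succ (q : ℂ) (n k : ℕ) :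
    gaussBinom q (n + 1) (k + 1) = gaussBinom q n (k + 1) + q ^ (n - k) * gaussBinom q n k :=
  rfl

lemma gaussBinom_eq_zero_of_lt (q : ℂ) {n k : ℕ} (h : n < k) : gaussBinom q n k = 0 := by
  induction n generalizing k with
  | zero =>
    obtain ⟨k, rfl⟩ := Nat.exists_eq_succ_of_ne_zero h.ne'
    rfl
  | succ n ih =>
    obtain ⟨k, rfl⟩ := Nat.exists_eq_succ_of_ne_zero (Nat.ne_zero_of_lt h)
    rw [Nat.succ_eq_add_one, gaussBinom_succ_succ, ih (by omega), ih (by omega), mul_zero, add_zero]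

lemma gaussBinom_mul_qPoch (q : ℂ) (k l : ℕ) :
    gaussBinom q (k + l) k * (qPoch q k * qPoch q l) = qPoch q (k + l) := by
  induction k generalizing l with
  | zero => simp [gaussBinom_zero_right, qPoch]
  | succ k ihk =>
    induction l with
    | zero =>
      have h := ihk 0
      rw [add_zero] at h ⊢
      rw [gaussBinom_succ_succ, gaussBinom_eq_zero_of_lt q k.lt_succ_self, qPoch_succ, Nat.sub_self]
      linear_combination (1 - q ^ (k + 1)) * h
    | succ l ihl =>
      have h := ihk (l + 1)
      rw [show k + 1 + l = k + (l + 1) by ring] at ihl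
      rw [show k + 1 + (l + 1) = k + (l + 1) + 1 by ring, gaussBinom_succ_succ,
        qPoch_succ q (k + (l + 1)), Nat.add_sub_cancel_left]
      rw [qPoch_succ q l] at h ⊢
      rw [qPoch_succ q k] at ihl ⊢
      linear_combination (1 - q ^ (l + 1)) * ihl + q ^ (l + 1) * (1 - q ^ (k + 1)) * h

/-- The `q`-binomial theorem, for the weights of a theta series. -/
lemma sum_gaussBinom_mul {q w : ℂ} (hq : q ≠ 0) (hw : w ≠ 0) {t : ℤ → ℂ}
    (ht : ∀ n, t (n + 1) = -(w * q ^ (n + 1)) * t n) (a : ℤ) (N : ℕ) :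
    ∑ k ∈ range (N + 1), gaussBinom q N k * t (a - k) =
      t a * ∏ j ∈ range N, (1 - w⁻¹ * q ^ ((j : ℤ) - a)) := by
  induction N with
  | zero => simp [gaussBinom_zero_right]
  | succ N ih =>
    have hstep : ∀ k ∈ range (N + 1), q ^ (N - k) * gaussBinom q N k * t (a - (k + 1 : ℕ)) =
        -(w⁻¹ * q ^ ((N : ℤ) - a)) * (gaussBinom q N k * t (a - k)) := by
      intro k hk
      have h := ht (a - (k + 1 : ℕ))
      rw [show a - ((k + 1 : ℕ) : ℤ) + 1 = a - k by push_cast; ring] at h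
      have hp : q ^ (N - k) = q ^ ((N : ℤ) - a) * q ^ (a - k) := by
        rw [← zpow_add₀ hq, ← zpow_natCast]
        congr 1
        have := mem_range.mp hk
        omega
      rw [h, hp]
      field_simp
    rw [prod_range_succ, ← mul_assoc, ← ih, sum_range_succ']
    simp_rw [gaussBinom_succ_succ, add_mul]
    rw [sum_add_distrib, sum_congr rfl hstep, ← mul_sum, sum_range_succ,
      gaussBinom_eq_zero_of_lt q N.lt_succ_self]
    rw [sum_range_succ' (fun k ↦ gaussBinom q N k * t (a - k))]
    simp only [gaussBinom_zero_right]
    ring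

lemma theta_weight_mul_prod {q w : ℂ} (hq : q ≠ 0) (hw : w ≠ 0) {t : ℤ → ℂ}
    (ht : ∀ n, t (n + 1) = -(w * q ^ (n + 1)) * t n) (m : ℕ) :
    t m * ∏ j ∈ range (2 * m + 1), (1 - w⁻¹ * q ^ ((j : ℤ) - m)) =
      t 0 * (1 - w⁻¹) *
        ∏ k ∈ range m, ((1 - w * q ^ (k + 1)) * (1 - w⁻¹ * q ^ (k + 1))) := by
  induction m with
  | zero => simp
  | succ m ih =>
    rw [prod_range_succ _ m, ← mul_assoc, ← ih, show 2 * (m + 1) + 1 = 2 * m + 1 + 1 + 1 by ring,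
      prod_range_succ, prod_range_succ']
    have h := ht m
    have e1 : ∀ j : ℕ, ((j + 1 : ℕ) : ℤ) - ((m + 1 : ℕ) : ℤ) = j - m := by
      intro j; push_cast; ring
    have e2 : ((2 * m + 1 : ℕ) : ℤ) - m = (m + 1 : ℕ) := by push_cast; ring
    have e3 : ((0 : ℕ) : ℤ) - ((m + 1 : ℕ) : ℤ) = -(m + 1 : ℕ) := by push_cast; ring
    have e4 : (m : ℤ) + 1 = (m + 1 : ℕ) := by push_cast; ring
    rw [e4] at h
    simp only [e1]
    rw [e2, e3, h, zpow_neg, zpow_natCast]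
    have : q ^ (m + 1) ≠ 0 := pow_ne_zero _ hq
    field_simp
    ring

/-- The finite form of the Jacobi triple product identity. -/
lemma tsum_gaussBinom_mul {q w : ℂ} (hq : q ≠ 0) (hw : w ≠ 0) {t : ℤ → ℂ}
    (ht : ∀ n, t (n + 1) = -(w * q ^ (n + 1)) * t n) (m : ℕ) :
    ∑' n : ℤ, (if n ≤ m then gaussBinom q (2 * m + 1) (m - n).toNat * t n else 0) =
      t 0 * (1 - w⁻¹) *
        ∏ k ∈ range m, ((1 - w * q ^ (k + 1)) * (1 - w⁻¹ * q ^ (k + 1))) := by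
  have hinj : Function.Injective (fun k : ℕ ↦ (m : ℤ) - k) := fun a b h ↦ by simpa using h
  rw [← hinj.tsum_eq, tsum_eq_sum (s := range (2 * m + 1 + 1)),
    ← theta_weight_mul_prod hq hw ht, ← sum_gaussBinom_mul hq hw ht]
  · refine sum_congr rfl fun k _ ↦ ?_
    simp
  · intro k hk
    rw [mem_range, not_lt] at hk
    simp [gaussBinom_eq_zero_of_lt q (show 2 * m + 1 < k by omega)]
  · intro n hn
    by_cases h : n ≤ m
    · exact ⟨(m - n).toNat, by simp only; omega⟩
    · simp [h] at hn

end Finite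

section Limit

open Filter Topology Finset

lemma summable_mul_pow_succ {q : ℂ} (hq : ‖q‖ < 1) (c : ℂ) :
    Summable fun n : ℕ ↦ ‖c * q ^ (n + 1)‖ := by
  simpa [pow_succ] using
    ((summable_geometric_of_lt_one (norm_nonneg q) hq).mul_right ‖q‖).mul_left ‖c‖

lemma multipliable_one_sub_mul_pow_succ {q : ℂ} (hq : ‖q‖ < 1) (c : ℂ) :
    Multipliable fun n : ℕ ↦ 1 - c * q ^ (n + 1) := by
  simpa [sub_eq_add_neg] using
    multipliable_one_add_of_summable (f := fun n : ℕ ↦ -(c * q ^ (n + 1)))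
      (by simpa only [norm_neg] using summable_mul_pow_succ hq c)

lemma one_sub_pow_succ_ne_zero {q : ℂ} (hq : ‖q‖ < 1) (n : ℕ) : 1 - q ^ (n + 1) ≠ 0 := by
  intro h
  have h1 : ‖q ^ (n + 1)‖ = 1 := by rw [← sub_eq_zero.mp h, norm_one]
  rw [norm_pow] at h1
  exact (pow_lt_one₀ (norm_nonneg q) hq n.succ_ne_zero).ne h1

lemma qPoch_ne_zero {q : ℂ} (hq : ‖q‖ < 1) (n : ℕ) : qPoch q n ≠ 0 :=
  prod_ne_zero_iff.mpr fun k _ ↦ one_sub_pow_succ_ne_zero hq k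

lemma tprod_one_sub_pow_succ_ne_zero {q : ℂ} (hq : ‖q‖ < 1) :
    ∏' n : ℕ, (1 - q ^ (n + 1)) ≠ 0 := by
  simp_rw [sub_eq_add_neg]
  refine tprod_one_add_ne_zero_of_summable (f := fun n : ℕ ↦ -q ^ (n + 1)) (fun n ↦ ?_) ?_
  · simpa [sub_eq_add_neg] using one_sub_pow_succ_ne_zero hq n
  · simpa using summable_mul_pow_succ hq 1

lemma tendsto_qPoch {q : ℂ} (hq : ‖q‖ < 1) :
    Tendsto (qPoch q) atTop (𝓝 (∏' n : ℕ, (1 - q ^ (n + 1)))) := by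
  have h := (multipliable_one_sub_mul_pow_succ hq 1).hasProd.tendsto_prod_nat
  simp only [one_mul] at h
  exact h

lemma gaussBinom_add_eq {q : ℂ} (hq : ‖q‖ < 1) (k l : ℕ) :
    gaussBinom q (k + l) k = qPoch q (k + l) * ((qPoch q k)⁻¹ * (qPoch q l)⁻¹) := by
  have := qPoch_ne_zero hq k
  have := qPoch_ne_zero hq l
  rw [← gaussBinom_mul_qPoch]
  field_simp

lemma exists_norm_gaussBinom_le {q : ℂ} (hq : ‖q‖ < 1) :
    ∃ C : ℝ, 0 ≤ C ∧ ∀ n k, ‖gaussBinom q n k‖ ≤ C := by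
  have hlim := tendsto_qPoch hq
  obtain ⟨A, hA⟩ := (Metric.isBounded_range_of_tendsto _ hlim).exists_norm_le
  obtain ⟨B, hB⟩ := (Metric.isBounded_range_of_tendsto _
    (hlim.inv₀ (tprod_one_sub_pow_succ_ne_zero hq))).exists_norm_le
  have hA' : ∀ n, ‖qPoch q n‖ ≤ A := fun n ↦ hA _ ⟨n, rfl⟩
  have hB' : ∀ n, ‖(qPoch q n)⁻¹‖ ≤ B := fun n ↦ hB _ ⟨n, rfl⟩
  have hA0 : 0 ≤ A := (norm_nonneg _).trans (hA' 0)
  have hB0 : 0 ≤ B := (norm_nonneg _).trans (hB' 0)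
  refine ⟨A * (B * B), by positivity, fun n k ↦ ?_⟩
  rcases lt_or_ge n k with h | h
  · rw [gaussBinom_eq_zero_of_lt q h, norm_zero]
    positivity
  · obtain ⟨l, rfl⟩ := Nat.exists_eq_add_of_le h
    rw [gaussBinom_add_eq hq, norm_mul, norm_mul]
    gcongr
    exacts [hA' _, hB' _, hB' _]

lemma tendsto_gaussBinom_central {q : ℂ} (hq : ‖q‖ < 1) (n : ℤ) :
    Tendsto (fun m : ℕ ↦ gaussBinom q (2 * m + 1) (m - n).toNat) atTop
      (𝓝 (∏' n : ℕ, (1 - q ^ (n + 1)))⁻¹) := by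
  have hlim := tendsto_qPoch hq
  have hne := tprod_one_sub_pow_succ_ne_zero hq
  have h0 : Tendsto (fun m : ℕ ↦ 2 * m + 1) atTop atTop :=
    tendsto_atTop_mono (fun m ↦ by simp only [id]; omega) tendsto_id
  have h1 : Tendsto (fun m : ℕ ↦ ((m : ℤ) - n).toNat) atTop atTop :=
    tendsto_atTop.mpr fun b ↦ by
      filter_upwards [eventually_ge_atTop (b + n.natAbs)] with m hm
      omega
  have h2 : Tendsto (fun m : ℕ ↦ ((m : ℤ) + 1 + n).toNat) atTop atTop :=
    tendsto_atTop.mpr fun b ↦ by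
      filter_upwards [eventually_ge_atTop (b + n.natAbs)] with m hm
      omega
  have h := (hlim.comp h0).mul
    (((hlim.comp h1).inv₀ hne).mul ((hlim.comp h2).inv₀ hne))
  rw [mul_inv_cancel_left₀ hne] at h
  refine h.congr' ?_
  filter_upwards [eventually_ge_atTop n.natAbs] with m hm
  have e : 2 * m + 1 = ((m : ℤ) - n).toNat + ((m : ℤ) + 1 + n).toNat := by omega
  simp only [Function.comp_apply]
  rw [e, gaussBinom_add_eq hq]

/-- The Jacobi triple product identity, for a theta series given by its two-term recursion. -/
theorem tsum_eq_triple_product {q w : ℂ} (hq : q ≠ 0) (hq1 : ‖q‖ < 1) (hw : w ≠ 0) {t : ℤ → ℂ}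
    (ht : ∀ n, t (n + 1) = -(w * q ^ (n + 1)) * t n) (hsum : Summable t) :
    ∑' n, t n = t 0 * (1 - w⁻¹) *
      ∏' k : ℕ, ((1 - w * q ^ (k + 1)) * (1 - w⁻¹ * q ^ (k + 1)) * (1 - q ^ (k + 1))) := by
  obtain ⟨C, hC0, hC⟩ := exists_norm_gaussBinom_le hq1
  have hne := tprod_one_sub_pow_succ_ne_zero hq1
  have hseries : Tendsto (fun m : ℕ ↦ ∑' n : ℤ,
      (if n ≤ m then gaussBinom q (2 * m + 1) (m - n).toNat * t n else 0)) atTop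
      (𝓝 (∑' n, (∏' k : ℕ, (1 - q ^ (k + 1)))⁻¹ * t n)) := by
    refine tendsto_tsum_of_dominated_convergence (hsum.norm.mul_left C) (fun n ↦ ?_)
      (Eventually.of_forall fun m n ↦ ?_)
    · refine ((tendsto_gaussBinom_central hq1 n).mul_const (t n)).congr' ?_
      filter_upwards [eventually_ge_atTop n.natAbs] with m hm
      rw [if_pos (by omega)]
    · split_ifs
      · rw [norm_mul]
        gcongr
        exact hC _ _
      · rw [norm_zero]
        positivity
  have hm2 := (multipliable_one_sub_mul_pow_succ hq1 w).mul
    (multipliable_one_sub_mul_pow_succ hq1 w⁻¹)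
  have hm3 : Multipliable fun k : ℕ ↦ 1 - q ^ (k + 1) := by
    simpa using multipliable_one_sub_mul_pow_succ hq1 1
  simp_rw [tsum_gaussBinom_mul hq hw ht] at hseries
  have hprod := hm2.hasProd.tendsto_prod_nat.const_mul (t 0 * (1 - w⁻¹))
  have key := tendsto_nhds_unique hseries hprod
  rw [tsum_mul_left, inv_mul_eq_iff_eq_mul₀ hne] at key
  rw [key, hm2.tprod_mul hm3]
  ring

end Limit

/-- The sum and product representations of the Jacobi theta function `θ₁` agree:
for `Im τ > 0`, `q = e^{2πiτ}`, `q^{1/8} = e^{πiτ/4}`, and all `z ∈ ℂ`,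
`-i ∑_{n ∈ ℤ} (-1)ⁿ e^{(n+1/2)² π i τ + (2n+1) i z}
  = 2 sin z · q^{1/8} · ∏_{n ≥ 1} (1 - 2 cos(2z) qⁿ + q^{2n})(1 - qⁿ)`
(the Jacobi triple product identity specialized to `θ₁`). -/
theorem jacobi_triple_product_theta (τ : ℂ) (hτ : 0 < τ.im) (z : ℂ) :
    -I * ∑' n : ℤ, (-1 : ℂ) ^ n *
        Complex.exp (((n : ℂ) + 1/2) ^ 2 * (Real.pi : ℂ) * I * τ + (2 * (n : ℂ) + 1) * I * z)
      = 2 * Complex.sin z * Complex.exp ((Real.pi : ℂ) * I * τ / 4) *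
        ∏' n : ℕ,
          (1 - 2 * Complex.cos (2 * z) * Complex.exp (2 * (Real.pi : ℂ) * I * τ) ^ (n + 1)
              + Complex.exp (2 * (Real.pi : ℂ) * I * τ) ^ (2 * (n + 1))) *
            (1 - Complex.exp (2 * (Real.pi : ℂ) * I * τ) ^ (n + 1)) := by
  set q := Complex.exp (2 * (Real.pi : ℂ) * I * τ) with hqdef
  set w := Complex.exp (2 * I * z) with hwdef
  set t : ℤ → ℂ := fun n ↦ (-1 : ℂ) ^ n *
    Complex.exp (((n : ℂ) + 1/2) ^ 2 * (Real.pi : ℂ) * I * τ + (2 * (n : ℂ) + 1) * I * z) with htdef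
  have hq1 : ‖q‖ < 1 := by
    rw [hqdef, Complex.norm_exp, Real.exp_lt_one_iff]
    have : (2 * (Real.pi : ℂ) * I * τ).re = -(2 * Real.pi * τ.im) := by simp
    rw [this, neg_lt_zero]
    positivity
  have ht : ∀ n, t (n + 1) = -(w * q ^ (n + 1)) * t n := by
    intro n
    simp only [htdef]
    rw [zpow_add_one₀ (by norm_num), hqdef, hwdef, ← Complex.exp_int_mul, ← Complex.exp_add,
      neg_mul, mul_left_comm, ← Complex.exp_add, mul_neg_one, neg_mul]
    congr 3
    push_cast
    ring
  have hsum : Summable t := by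
    have h := ((summable_jacobiTheta₂_term_iff (τ / 2 + z / Real.pi) τ).mpr hτ).norm.mul_right
      ‖Complex.exp (Real.pi * I * τ / 4 + I * z)‖
    refine Summable.of_norm (h.congr fun n ↦ ?_)
    have hpi : (Real.pi : ℂ) ≠ 0 := Complex.ofReal_ne_zero.mpr Real.pi_ne_zero
    simp only [htdef]
    rw [norm_mul, norm_zpow, norm_neg, norm_one, one_zpow, one_mul, jacobiTheta₂_term, ← norm_mul,
      ← Complex.exp_add]
    congr 2
    field_simp
    ring
  rw [tsum_eq_triple_product (Complex.exp_ne_zero _) hq1 (Complex.exp_ne_zero _) ht hsum]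
  have hw : w⁻¹ = Complex.exp (-(2 * I * z)) := (Complex.exp_neg _).symm
  have hcos : 2 * Complex.cos (2 * z) = w + w⁻¹ := by
    rw [Complex.two_cos, hw, hwdef]
    congr 2 <;> ring
  have hww : w * w⁻¹ = 1 := mul_inv_cancel₀ (Complex.exp_ne_zero _)
  have hpre : -I * (t 0 * (1 - w⁻¹)) =
      2 * Complex.sin z * Complex.exp ((Real.pi : ℂ) * I * τ / 4) := by
    have h0 : t 0 = Complex.exp ((Real.pi : ℂ) * I * τ / 4) * Complex.exp (z * I) := by
      simp only [htdef]
      rw [zpow_zero, one_mul, ← Complex.exp_add]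
      congr 1
      push_cast
      ring
    have h1 : Complex.exp (z * I) * w⁻¹ = Complex.exp (-z * I) := by
      rw [hw, ← Complex.exp_add]
      congr 1
      ring
    rw [Complex.two_sin, h0]
    linear_combination I * Complex.exp ((Real.pi : ℂ) * I * τ / 4) * h1
  rw [← mul_assoc, hpre]
  congr 1
  refine tprod_congr fun n ↦ ?_
  rw [hcos]
  linear_combination (1 - q ^ (n + 1)) * q ^ (2 * (n + 1)) * hww
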